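/- α-equivalence under a freshness context is equivariant: for any freshness context ∇, nominal terms t and s, and permutation π, if ∇ ⊢ t ≈ s then ∇ ⊢ π•t ≈ π•s. -/

import Mathlib

set_option maxHeartbeats 1000000
abbrev Atom := ℕ
abbrev Var := ℕ
abbrev Fn := ℕ
abbrev NPerm := List (Atom × Atom)
def swapAtom (a b c : Atom) : Atom := if c = a then b else if c = b then a else c
def permAtom : NPerm → Atom → Atom
  | [], c => c
  | (a, b) :: π, c => swapAtom a b (permAtom π c)
def permInv (π : NPerm) : NPerm := π.reverse
inductive NTerm where
  | app : Fn → List NTerm → NTerm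
  | atom : Atom → NTerm
  | abs : Atom → NTerm → NTerm
  | susp : NPerm → Var → NTerm

def permTerm (π : NPerm) : NTerm → NTerm
  | .app f ts => .app f (ts.attach.map (fun x => permTerm π x.1))
  | .atom a => .atom (permAtom π a)
  | .abs a t => .abs (permAtom π a) (permTerm π t)
  | .susp ρ X => .susp (π ++ ρ) X
decreasing_by
  all_goals (simp_wf; try omega)
  all_goals (have := List.sizeOf_lt_of_mem x.2; omega)

/-- Substitutions (total maps from variables to terms; identity almost everywhere
is not required for the statements). -/
abbrev NSubst := Var → NTerm

def idSubst : NSubst := fun X => .susp [] X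

/-- Application of a substitution to a term (allowing atom capture and forcing
suspended permutations). -/
def substTerm (σ : NSubst) : NTerm → NTerm
  | .app f ts => .app f (ts.attach.map (fun x => substTerm σ x.1))
  | .atom a => .atom a
  | .abs a t => .abs a (substTerm σ t)
  | .susp π X => permTerm π (σ X)
decreasing_by
  all_goals (simp_wf; try omega)
  all_goals (have := List.sizeOf_lt_of_mem x.2; omega)

/-- Composition of substitutions: `t (σθ) = (tσ)θ`. -/
def substComp (σ θ : NSubst) : NSubst := fun X => substTerm θ (σ X)

/-- Freshness contexts: finite sets of constraints `a # X`. -/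
abbrev FCtx := Finset (Atom × Var)

/-- The freshness relation `Δ ⊢ a # t` (Urban–Pitts–Gabbay rules), stated for an
arbitrary set of freshness constraints. -/
inductive NFresh (Δ : Set (Atom × Var)) : Atom → NTerm → Prop
  | atom {a b : Atom} : a ≠ b → NFresh Δ a (.atom b)
  | susp {a : Atom} {π : NPerm} {X : Var} :
      (permAtom (permInv π) a, X) ∈ Δ → NFresh Δ a (.susp π X)
  | app {a : Atom} {f : Fn} {ts : List NTerm} :
      (∀ t ∈ ts, NFresh Δ a t) → NFresh Δ a (.app f ts)
  | abs1 {a : Atom} {t : NTerm} : NFresh Δ a (.abs a t)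
  | abs2 {a b : Atom} {t : NTerm} : a ≠ b → NFresh Δ a t → NFresh Δ a (.abs b t)

/-- The α-equivalence relation `Δ ⊢ t ≈ s` (Urban–Pitts–Gabbay rules). -/
inductive NAlpha (Δ : Set (Atom × Var)) : NTerm → NTerm → Prop
  | atom (a : Atom) : NAlpha Δ (.atom a) (.atom a)
  | abs1 {a : Atom} {t t' : NTerm} : NAlpha Δ t t' → NAlpha Δ (.abs a t) (.abs a t')
  | abs2 {a b : Atom} {t t' : NTerm} : a ≠ b → NAlpha Δ t (permTerm [(a, b)] t') →
      NFresh Δ a t' → NAlpha Δ (.abs a t) (.abs b t')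
  | susp {π π' : NPerm} {X : Var} :
      (∀ a : Atom, permAtom π a ≠ permAtom π' a → (a, X) ∈ Δ) →
      NAlpha Δ (.susp π X) (.susp π' X)
  | app {f : Fn} {ts ss : List NTerm} : ts.length = ss.length →
      (∀ p ∈ List.zip ts ss, NAlpha Δ p.1 p.2) →
      NAlpha Δ (.app f ts) (.app f ss)

/-- `FA⁻ˢ(t)`: atoms occurring freely in `t`, ignoring suspensions. -/
def FAnoSusp : NTerm → Finset Atom
  | .app _ ts => (ts.attach.map (fun x => FAnoSusp x.1)).foldr (· ∪ ·) ∅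
  | .atom a => {a}
  | .abs a t => FAnoSusp t \ {a}
  | .susp _ _ => ∅
decreasing_by
  all_goals (simp_wf; try omega)
  all_goals (have := List.sizeOf_lt_of_mem x.2; omega)

/-- A substitution respects a freshness context. -/
def Respects (σ : NSubst) (Δ : FCtx) : Prop :=
  ∀ a X, (a, X) ∈ Δ → a ∉ FAnoSusp (σ X)

/-! ### The algorithm FC -/

/-- A finite set of atomic freshness formulas `a # t`. -/
abbrev FProb := Multiset (Atom × NTerm)

/-- One step of the algorithm FC, transforming pairs `(F; Δ)`. -/
inductive FCStep : FProb × FCtx → FProb × FCtx → Prop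
  | del {a b : Atom} {F : FProb} {Δ : FCtx} : a ≠ b →
      FCStep ((a, .atom b) ::ₘ F, Δ) (F, Δ)
  | abs1 {a : Atom} {t : NTerm} {F : FProb} {Δ : FCtx} :
      FCStep ((a, .abs a t) ::ₘ F, Δ) (F, Δ)
  | abs2 {a b : Atom} {t : NTerm} {F : FProb} {Δ : FCtx} : a ≠ b →
      FCStep ((a, .abs b t) ::ₘ F, Δ) ((a, t) ::ₘ F, Δ)
  | dec {a : Atom} {f : Fn} {ts : List NTerm} {F : FProb} {Δ : FCtx} :
      FCStep ((a, .app f ts) ::ₘ F, Δ) (↑(ts.map (fun t => (a, t))) + F, Δ)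
  | sus {a : Atom} {π : NPerm} {X : Var} {F : FProb} {Δ : FCtx} :
      FCStep ((a, .susp π X) ::ₘ F, Δ) (F, insert (permAtom (permInv π) a, X) Δ)

/-- The algorithm FC succeeds on `F` with result `Γ`. -/
def FCReaches (F : FProb) (Γ : FCtx) : Prop :=
  Relation.ReflTransGen FCStep (F, ∅) (0, Γ)

/-- The algorithm FC fails on `F` (reaches a stuck state with remaining formulas). -/
def FCFails (F : FProb) : Prop :=
  ∃ st : FProb × FCtx, Relation.ReflTransGen FCStep (F, ∅) st ∧ st.1 ≠ 0 ∧
    ∀ st', ¬ FCStep st st'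

/-- The freshness problem `{a # Xσ | a#X ∈ Δ}` defining the instance `Δσ`. -/
def ctxSubstProb (Δ : FCtx) (σ : NSubst) : FProb :=
  Δ.val.map (fun c => (c.1, σ c.2))

/-! ### Terms-in-context and the subsumption order -/

/-- A term-in-context. -/
abbrev TIC := FCtx × NTerm

/-- `p ⪯ q`: the term-in-context `p` is more general than `q`.  (The condition
`p.1 σ ⊆ q.1` is expressed, equivalently by the properties of FC, as
`q.1 ⊢ a # Xσ` for all `a # X ∈ p.1`.) -/
def TIC.Le (p q : TIC) : Prop :=
  ∃ σ : NSubst, Respects σ p.1 ∧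
    (∀ c ∈ p.1, NFresh (↑q.1 : Set (Atom × Var)) c.1 (σ c.2)) ∧
    NAlpha (↑q.1 : Set (Atom × Var)) (substTerm σ p.2) q.2

/-- The strict part of `⪯`. -/
def TIC.Lt (p q : TIC) : Prop := TIC.Le p q ∧ ¬ TIC.Le q p

/-- Equi-generality `≃`. -/
def TIC.Equiv (p q : TIC) : Prop := TIC.Le p q ∧ TIC.Le q p

/-- `r` is a generalization of `p₁` and `p₂`. -/
def IsGen (r p₁ p₂ : TIC) : Prop := TIC.Le r p₁ ∧ TIC.Le r p₂

/-! ### Atoms, variables, basedness -/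

def permAtoms : NPerm → Finset Atom
  | [] => ∅
  | (a, b) :: π => insert a (insert b (permAtoms π))

def termAtoms : NTerm → Finset Atom
  | .app _ ts => (ts.attach.map (fun x => termAtoms x.1)).foldr (· ∪ ·) ∅
  | .atom a => {a}
  | .abs a t => insert a (termAtoms t)
  | .susp π _ => permAtoms π
decreasing_by
  all_goals (simp_wf; try omega)
  all_goals (have := List.sizeOf_lt_of_mem x.2; omega)

def termVars : NTerm → Finset Var
  | .app _ ts => (ts.attach.map (fun x => termVars x.1)).foldr (· ∪ ·) ∅
  | .atom _ => ∅
  | .abs _ t => termVars t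
  | .susp _ X => {X}
decreasing_by
  all_goals (simp_wf; try omega)
  all_goals (have := List.sizeOf_lt_of_mem x.2; omega)

/-- `FA(t)`: the atoms occurring freely in `t` (with `FA(π·X) = Atoms(π)`). -/
def termFA : NTerm → Finset Atom
  | .app _ ts => (ts.attach.map (fun x => termFA x.1)).foldr (· ∪ ·) ∅
  | .atom a => {a}
  | .abs a t => termFA t \ {a}
  | .susp π _ => permAtoms π
decreasing_by
  all_goals (simp_wf; try omega)
  all_goals (have := List.sizeOf_lt_of_mem x.2; omega)

def ctxAtoms (Δ : FCtx) : Finset Atom := Δ.image Prod.fst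
def ctxVars (Δ : FCtx) : Finset Var := Δ.image Prod.snd

def permBased (π : NPerm) (A : Finset Atom) : Prop := permAtoms π ⊆ A
def termBased (t : NTerm) (A : Finset Atom) : Prop := termAtoms t ⊆ A
def ctxBased (Δ : FCtx) (A : Finset Atom) : Prop := ctxAtoms Δ ⊆ A
def ticBased (p : TIC) (A : Finset Atom) : Prop := ctxBased p.1 A ∧ termBased p.2 A

/-- The number of abstraction occurrences in a term. -/
def absCount : NTerm → ℕ
  | .app _ ts => (ts.attach.map (fun x => absCount x.1)).sum
  | .atom _ => 0
  | .abs _ t => absCount t + 1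
  | .susp _ _ => 0
decreasing_by
  all_goals (simp_wf; try omega)
  all_goals (have := List.sizeOf_lt_of_mem x.2; omega)

/-! ### The nominal anti-unification algorithm 𝔑 -/

/-- Anti-unification triple `X : t ≜ s`. -/
abbrev AUT := Var × NTerm × NTerm

/-- A state of the algorithm 𝔑: the unsolved triples `P`, the store `S`, the
freshness context `Γ`, the substitution `σ`, and the set `V` of variables used
so far (needed to express freshness of the generated variables). -/
structure NState where
  P : Multiset AUT
  S : Multiset AUT
  Γ : FCtx
  σ : NSubst
  V : Finset Var

/-- `σ{X ↦ u}`. -/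
def updSubst (σ : NSubst) (X : Var) (u : NTerm) : NSubst :=
  substComp σ (fun Z => if Z = X then u else .susp [] Z)

/-- The head of a term (a function symbol together with its arity, an atom, the
abstraction operator, or a variable). -/
inductive NHead where
  | fn : Fn → ℕ → NHead
  | atom : Atom → NHead
  | abs : NHead
  | var : Var → NHead
deriving DecidableEq

def headOf : NTerm → NHead
  | .app f ts => .fn f ts.length
  | .atom a => .atom a
  | .abs _ _ => .abs
  | .susp _ X => .var X

def IsSusp : NTerm → Prop
  | .susp _ _ => True
  | _ => False

def IsAbs : NTerm → Prop
  | .abs _ _ => True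
  | _ => False

/-- The applicability condition of the rule Sol. -/
def SolCond (A : Finset Atom) (Δ : FCtx) (t s : NTerm) : Prop :=
  headOf t ≠ headOf s ∨ (IsSusp t ∧ IsSusp s) ∨
    (IsAbs t ∧ IsAbs s ∧
      ¬ ∃ c ∈ A, NFresh (↑Δ : Set (Atom × Var)) c t ∧ NFresh (↑Δ : Set (Atom × Var)) c s)

open Classical in
/-- `{a # X | a ∈ A, Δ ⊢ a # t, Δ ⊢ a # s}`. -/
noncomputable def solSet (A : Finset Atom) (Δ : FCtx) (t s : NTerm) (X : Var) : FCtx :=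
  (A.filter (fun a =>
    NFresh (↑Δ : Set (Atom × Var)) a t ∧ NFresh (↑Δ : Set (Atom × Var)) a s)).image
    (fun a => (a, X))

/-- `Γ{Y ↦ π·X}` on a freshness context. -/
def ctxRename (Γ : FCtx) (Y : Var) (π : NPerm) (X : Var) : FCtx :=
  Γ.image (fun c => if c.2 = Y then (permAtom (permInv π) c.1, X) else c)

/-- One step of the algorithm 𝔑, with global parameters `A` and `Δ`. -/
inductive NStep (A : Finset Atom) (Δ : FCtx) : NState → NState → Prop
  | decApp {X : Var} {f : Fn} {ts ss : List NTerm} {P S : Multiset AUT} {Γ : FCtx}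
      {σ : NSubst} {V : Finset Var} (Ys : List Var) :
      ts.length = ss.length → Ys.length = ts.length → Ys.Nodup →
      (∀ Y ∈ Ys, Y ∉ V) →
      NStep A Δ ⟨(X, .app f ts, .app f ss) ::ₘ P, S, Γ, σ, V⟩
        ⟨↑(List.zipWith (fun Y p => (Y, p)) Ys (List.zip ts ss)) + P, S, Γ,
         updSubst σ X (.app f (Ys.map (fun Y => .susp [] Y))), V ∪ Ys.toFinset⟩
  | decAtom {X : Var} {a : Atom} {P S : Multiset AUT} {Γ : FCtx} {σ : NSubst}
      {V : Finset Var} :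
      NStep A Δ ⟨(X, .atom a, .atom a) ::ₘ P, S, Γ, σ, V⟩
        ⟨P, S, Γ, updSubst σ X (.atom a), V⟩
  | abs {X : Var} {a b : Atom} {t s : NTerm} {P S : Multiset AUT} {Γ : FCtx}
      {σ : NSubst} {V : Finset Var} (Y : Var) (c : Atom) :
      Y ∉ V → c ∈ A →
      NFresh (↑Δ : Set (Atom × Var)) c (.abs a t) →
      NFresh (↑Δ : Set (Atom × Var)) c (.abs b s) →
      NStep A Δ ⟨(X, .abs a t, .abs b s) ::ₘ P, S, Γ, σ, V⟩
        ⟨(Y, permTerm [(c, a)] t, permTerm [(c, b)] s) ::ₘ P, S, Γ,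
         updSubst σ X (.abs c (.susp [] Y)), insert Y V⟩
  | sol {X : Var} {t s : NTerm} {P S : Multiset AUT} {Γ : FCtx} {σ : NSubst}
      {V : Finset Var} :
      SolCond A Δ t s →
      NStep A Δ ⟨(X, t, s) ::ₘ P, S, Γ, σ, V⟩
        ⟨P, (X, t, s) ::ₘ S, Γ ∪ solSet A Δ t s X, σ, V⟩
  | mer {X Y : Var} {t₁ s₁ t₂ s₂ : NTerm} {P S : Multiset AUT} {Γ : FCtx}
      {σ : NSubst} {V : Finset Var} (π : NPerm) :
      X ≠ Y →
      permBased π (termAtoms t₁ ∪ termAtoms s₁ ∪ termAtoms t₂ ∪ termAtoms s₂) →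
      NAlpha (↑Δ : Set (Atom × Var)) (permTerm π t₁) t₂ →
      NAlpha (↑Δ : Set (Atom × Var)) (permTerm π s₁) s₂ →
      NStep A Δ ⟨P, (X, t₁, s₁) ::ₘ (Y, t₂, s₂) ::ₘ S, Γ, σ, V⟩
        ⟨P, (X, t₁, s₁) ::ₘ S, ctxRename Γ Y π X, updSubst σ Y (.susp π X), V⟩

/-- The initial state of 𝔑 on the triple `X : t ≜ s`. -/
def initNState (X : Var) (t s : NTerm) (Δ : FCtx) : NState :=
  ⟨{(X, t, s)}, 0, ∅, idSubst, insert X (termVars t ∪ termVars s ∪ ctxVars Δ)⟩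

/-- An `A`-based least general generalization of `p₁` and `p₂`. -/
def IsABasedLgg (A : Finset Atom) (p p₁ p₂ : TIC) : Prop :=
  ticBased p A ∧ IsGen p p₁ p₂ ∧
    ¬ ∃ p' : TIC, ticBased p' A ∧ IsGen p' p₁ p₂ ∧ TIC.Lt p p'

/-! ### The equivariance algorithm 𝔈 -/

/-- A set of equivariance equations `t ≈ s`. -/
abbrev EProb := Multiset (NTerm × NTerm)

def eqsAtoms (E : EProb) : Finset Atom :=
  (E.map (fun e => termAtoms e.1 ∪ termAtoms e.2)).sup

def eqsVars (E : EProb) : Finset Var :=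
  (E.map (fun e => termVars e.1 ∪ termVars e.2)).sup

/-- All equations of `E` are equations between atoms. -/
def AtomEqs (E : EProb) : Prop := ∀ e ∈ E, ∃ a b : Atom, e = (NTerm.atom a, NTerm.atom b)

/-- One step of the equivariance algorithm 𝔈 (with fixed freshness context `Δ`) on
states `(E; A; π)`.  The first-phase rules require `π = Id`; the second-phase
rules require that only equations between atoms are left. -/
inductive EStep (Δ : FCtx) :
    EProb × Finset Atom × NPerm → EProb × Finset Atom × NPerm → Prop
  | dec {f : Fn} {ts ss : List NTerm} {E : EProb} {A : Finset Atom} :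
      ts.length = ss.length →
      EStep Δ ((.app f ts, .app f ss) ::ₘ E, A, []) (↑(List.zip ts ss) + E, A, [])
  | alp {a b : Atom} {t s : NTerm} {E : EProb} {A : Finset Atom} (c : Atom) :
      c ∉ A → c ∉ eqsAtoms ((.abs a t, .abs b s) ::ₘ E) → c ∉ ctxAtoms Δ →
      EStep Δ ((.abs a t, .abs b s) ::ₘ E, A, [])
        ((permTerm [(c, a)] t, permTerm [(c, b)] s) ::ₘ E, A, [])
  | sus {π₁ π₂ : NPerm} {X : Var} {E : EProb} {A : Finset Atom} :
      EStep Δ ((.susp π₁ X, .susp π₂ X) ::ₘ E, A, [])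
        (↑((A.filter (fun a => (a, X) ∉ Δ)).toList.map
            (fun a => (NTerm.atom (permAtom π₁ a), NTerm.atom (permAtom π₂ a)))) + E,
         A, [])
  | rem {a b : Atom} {E : EProb} {A : Finset Atom} {π : NPerm} :
      AtomEqs ((.atom a, .atom b) ::ₘ E) → permAtom π a = b →
      EStep Δ ((.atom a, .atom b) ::ₘ E, A, π) (E, A.erase b, π)
  | sol {a b : Atom} {E : EProb} {A : Finset Atom} {π : NPerm} :
      AtomEqs ((.atom a, .atom b) ::ₘ E) →
      permAtom π a ∈ A → b ∈ A → permAtom π a ≠ b →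
      EStep Δ ((.atom a, .atom b) ::ₘ E, A, π) (E, A.erase b, (permAtom π a, b) :: π)

/-- Structural induction on nominal terms, with the hypothesis for the arguments of a function
symbol stated by membership. -/
theorem NTerm.induction_on_mem {P : NTerm → Prop}
    (app : ∀ f ts, (∀ t ∈ ts, P t) → P (.app f ts))
    (atom : ∀ a, P (.atom a))
    (abs : ∀ a t, P t → P (.abs a t))
    (susp : ∀ π X, P (.susp π X)) (t : NTerm) : P t :=
  NTerm.rec (motive_1 := P) (motive_2 := fun ts => ∀ t ∈ ts, P t)
    app atom abs susp (by simp) (by simp +contextual) t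

@[simp] theorem permTerm_app (π : NPerm) (f : Fn) (ts : List NTerm) :
    permTerm π (.app f ts) = .app f (ts.map (permTerm π)) := by
  rw [permTerm, List.attach_map_val (f := permTerm π)]

@[simp] theorem permTerm_atom (π : NPerm) (a : Atom) :
    permTerm π (.atom a) = .atom (permAtom π a) := by
  rw [permTerm]

@[simp] theorem permTerm_abs (π : NPerm) (a : Atom) (t : NTerm) :
    permTerm π (.abs a t) = .abs (permAtom π a) (permTerm π t) := by
  rw [permTerm]

@[simp] theorem permTerm_susp (π ρ : NPerm) (X : Var) :
    permTerm π (.susp ρ X) = .susp (π ++ ρ) X := by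
  rw [permTerm]

theorem swapAtom_swapAtom (a b c : Atom) : swapAtom a b (swapAtom a b c) = c := by
  unfold swapAtom; grind

theorem permAtom_append (π ρ : NPerm) (c : Atom) :
    permAtom (π ++ ρ) c = permAtom π (permAtom ρ c) := by
  induction π with
  | nil => rfl
  | cons p π ih => simp [permAtom, ih]

theorem permAtom_permInv (π : NPerm) (c : Atom) : permAtom (permInv π) (permAtom π c) = c := by
  induction π generalizing c with
  | nil => rfl
  | cons p π ih =>
    simp only [permInv] at ih
    simp [permInv, permAtom_append, permAtom, swapAtom_swapAtom, ih]

theorem permInv_permInv (π : NPerm) : permInv (permInv π) = π := List.reverse_reverse π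

theorem permAtom_injective (π : NPerm) : Function.Injective (permAtom π) :=
  Function.LeftInverse.injective (permAtom_permInv π)

theorem permAtom_permInv_right (π : NPerm) (c : Atom) :
    permAtom π (permAtom (permInv π) c) = c := by
  simpa only [permInv_permInv] using permAtom_permInv (permInv π) c

theorem permInv_append (π ρ : NPerm) : permInv (π ++ ρ) = permInv ρ ++ permInv π :=
  List.reverse_append

theorem permAtom_swapAtom (π : NPerm) (a b c : Atom) :
    permAtom π (swapAtom a b c) = swapAtom (permAtom π a) (permAtom π b) (permAtom π c) := by
  have hπ := permAtom_injective π
  simp only [swapAtom, hπ.eq_iff]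
  split_ifs <;> rfl

theorem permTerm_append (π ρ : NPerm) (t : NTerm) :
    permTerm (π ++ ρ) t = permTerm π (permTerm ρ t) := by
  induction t using NTerm.induction_on_mem with
  | app f ts ih => simpa using ih
  | atom a => simp [permAtom_append]
  | abs a t ih => simp [permAtom_append, ih]
  | susp σ X => simp

/-- Freshness only depends on the action of a permutation on atoms. -/
theorem NFresh.permTerm_congr {Δ : Set (Atom × Var)} {ρ ρ' : NPerm}
    (hρ : ∀ c, permAtom ρ c = permAtom ρ' c) {a : Atom} {t : NTerm}
    (h : NFresh Δ a (permTerm ρ t)) : NFresh Δ a (permTerm ρ' t) := by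
  induction t using NTerm.induction_on_mem with
  | app f ts ih =>
    simp only [permTerm_app] at h ⊢
    cases h with
    | app h =>
      refine .app fun u hu => ?_
      obtain ⟨t, ht, rfl⟩ := List.mem_map.1 hu
      exact ih t ht (h _ (List.mem_map_of_mem ht))
  | atom b => simpa only [permTerm_atom, hρ] using h
  | abs b t ih =>
    simp only [permTerm_abs, hρ] at h ⊢
    cases h with
    | abs1 => exact .abs1
    | abs2 hab h => exact .abs2 hab (ih h)
  | susp σ X =>
    simp only [permTerm_susp] at h ⊢
    cases h with
    | susp h =>
      have hinv : permAtom (permInv ρ') a = permAtom (permInv ρ) a :=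
        permAtom_injective ρ' (by rw [permAtom_permInv_right, ← hρ, permAtom_permInv_right])
      refine .susp ?_
      rwa [permInv_append, permAtom_append, hinv, ← permAtom_append, ← permInv_append]

/-- Freshness is equivariant. -/
theorem NFresh.permTerm {Δ : Set (Atom × Var)} {a : Atom} {t : NTerm} (π : NPerm)
    (h : NFresh Δ a t) : NFresh Δ (permAtom π a) (permTerm π t) := by
  have hπ := permAtom_injective π
  induction h with
  | atom hab => simpa using NFresh.atom (hπ.ne hab)
  | susp h =>
    rw [permTerm_susp]
    refine .susp ?_
    rwa [permInv_append, permAtom_append, permAtom_permInv]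
  | app _ ih =>
    rw [permTerm_app]
    refine .app fun u hu => ?_
    obtain ⟨t, ht, rfl⟩ := List.mem_map.1 hu
    exact ih t ht
  | abs1 => simpa using NFresh.abs1
  | abs2 hab _ ih => simpa using NFresh.abs2 (hπ.ne hab) ih

/-- α-equivalence only depends on the action of a permutation on atoms. -/
theorem NAlpha.permTerm_congr_right {Δ : Set (Atom × Var)} {ρ ρ' : NPerm}
    (hρ : ∀ c, permAtom ρ c = permAtom ρ' c) {t s : NTerm}
    (h : NAlpha Δ t (permTerm ρ s)) : NAlpha Δ t (permTerm ρ' s) := by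
  induction s using NTerm.induction_on_mem generalizing t ρ ρ' with
  | app f ss ih =>
    simp only [permTerm_app] at h ⊢
    cases h with
    | app hlen h =>
      refine .app (by simpa using hlen) ?_
      simp only [List.zip_map_right, List.mem_map, forall_exists_index, and_imp,
        forall_apply_eq_imp_iff₂] at h ⊢
      exact fun p hp => ih p.2 (List.of_mem_zip hp).2 hρ (h p hp)
  | atom b => simpa only [permTerm_atom, hρ] using h
  | abs b s ih =>
    simp only [permTerm_abs, hρ] at h ⊢
    cases h with
    | abs1 h => exact .abs1 (ih hρ h)
    | abs2 hab h hf =>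
      refine .abs2 hab ?_ (hf.permTerm_congr hρ)
      rw [← permTerm_append] at h ⊢
      exact ih (fun c => by rw [permAtom_append, permAtom_append, hρ]) h
  | susp σ X =>
    simp only [permTerm_susp] at h ⊢
    cases h with
    | susp h =>
      refine .susp fun c hc => h c ?_
      rwa [permAtom_append, hρ, ← permAtom_append]

/-- α-equivalence under an arbitrary set of freshness constraints is equivariant. -/
theorem NAlpha.permTerm {Δ : Set (Atom × Var)} {t s : NTerm} (π : NPerm)
    (h : NAlpha Δ t s) : NAlpha Δ (permTerm π t) (permTerm π s) := by
  have hπ := permAtom_injective π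
  induction h with
  | atom a => simpa using NAlpha.atom _
  | abs1 _ ih => simpa using NAlpha.abs1 ih
  | @abs2 a b t s hab _ hf ih =>
    simp only [permTerm_abs]
    refine .abs2 (hπ.ne hab) ?_ (hf.permTerm π)
    rw [← permTerm_append] at ih ⊢
    refine ih.permTerm_congr_right fun c => ?_
    simp only [permAtom_append, permAtom, permAtom_swapAtom]
  | susp h =>
    simp only [permTerm_susp]
    refine .susp fun c hc => h c fun he => hc ?_
    rw [permAtom_append, permAtom_append, he]
  | app hlen _ ih =>
    simp only [permTerm_app]
    refine .app (by simpa using hlen) ?_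
    simp only [List.zip_map, List.mem_map, forall_exists_index, and_imp,
      forall_apply_eq_imp_iff₂]
    exact ih

/-- α-equivalence under a freshness context is equivariant. -/
theorem alpha_equivariant (Δ : FCtx) (t s : NTerm) (π : NPerm)
    (h : NAlpha (↑Δ : Set (Atom × Var)) t s) :
    NAlpha (↑Δ : Set (Atom × Var)) (permTerm π t) (permTerm π s) :=
  h.permTerm π
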